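/- Let L be an n×n invertible SDDM matrix with integer entries in [-U, U] (U ≥ 2, n ≥ 2), let S ⊆ [n], and let b̂ be a nonnegative vector indexed by S with support I := {u ∈ S : b̂_u > 0}. Let H be a set with I ⊆ H ⊆ S, let ε_L ∈ (0, 1), and suppose there is a real r with r ≥ 5 + log_{nU}(2/ε_L) such that the probability distance with respect to the principal submatrix L_{S,S} satisfies D_{L_{S,S}}(u, v) > r for all u ∈ S \ H and v ∈ I. Let x̂ be the vector indexed by S that is zero on S \ H and whose restriction to H satisfies ‖x̂_H − (L_{H,H})⁻¹ b̂_H‖₂ ≤ (ε_L/2) ‖b̂_H‖₂. Then ‖x̂ − (L_{S,S})⁻¹ b̂‖₂ ≤ ε_L ‖b̂‖₂. -/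

import Mathlib

lemma ps_mono {ι : Type*} [Fintype ι] [DecidableEq ι] (M : Matrix ι ι ℝ) (hP : M.PosDef)
    (hoff : ∀ i j, i ≠ j → M i j ≤ 0) (z : ι → ℝ) (hz : ∀ i, 0 ≤ M.mulVec z i) : ∀ i, 0 ≤ z i := by
  by_contra hcon
  push Not at hcon
  obtain ⟨i0, hi0⟩ := hcon
  set w : ι → ℝ := fun i => max (-z i) 0 with hw
  have hw0 : w ≠ 0 := by
    intro h
    have := congrFun h i0
    simp only [hw, Pi.zero_apply] at this
    have h2 := le_max_left (-z i0) 0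
    linarith
  have hpos : 0 < dotProduct w (M.mulVec w) := by
    have := hP.dotProduct_mulVec_pos hw0
    simpa using this
  have h1 : 0 ≤ dotProduct w (M.mulVec z) :=
    Finset.sum_nonneg fun i _ => mul_nonneg (le_max_right _ _) (hz i)
  have h2 : dotProduct w (M.mulVec (z + w)) ≤ 0 := by
    refine Finset.sum_nonpos fun i _ => ?_
    simp only [Matrix.mulVec, dotProduct, Finset.mul_sum]
    refine Finset.sum_nonpos fun j _ => ?_
    have hwi : 0 ≤ w i := le_max_right _ _
    have hzj : 0 ≤ (z + w) j := by
      have := le_max_left (-z j) 0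
      simp only [Pi.add_apply, hw]; linarith
    by_cases hij : i = j
    · subst hij
      have : w i * (z + w) i = 0 := by
        simp only [Pi.add_apply, hw]
        rcases le_total (-z i) 0 with h | h
        · rw [max_eq_right h]; ring
        · rw [max_eq_left h]; ring
      have h3 : w i * (M i i * (z + w) i) = M i i * (w i * (z + w) i) := by ring
      rw [h3, this, mul_zero]
    · exact mul_nonpos_of_nonneg_of_nonpos hwi (mul_nonpos_of_nonpos_of_nonneg (hoff i j hij) hzj)
  rw [Matrix.mulVec_add, dotProduct_add] at h2
  linarith

lemma ps_posDef {ι : Type*} [Fintype ι] [DecidableEq ι] (L : Matrix ι ι ℝ)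
    (hsymm : L.IsSymm)
    (hdd : ∀ i, ∑ j ∈ Finset.univ.filter (fun j => j ≠ i), |L i j| ≤ L i i)
    (hinv : IsUnit L) : L.PosDef := by
  have hH : L.IsHermitian := by
    rw [Matrix.IsHermitian, Matrix.conjTranspose_eq_transpose_of_trivial]; exact hsymm
  have hps : L.PosSemidef := by
    refine Matrix.PosSemidef.of_dotProduct_mulVec_nonneg hH fun x => ?_
    have key : 2 * dotProduct x (L.mulVec x) = ∑ i, ∑ j, L i j * (2 * x i * x j) := by
      simp only [Matrix.mulVec, dotProduct, Finset.mul_sum]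
      exact Finset.sum_congr rfl fun i _ => Finset.sum_congr rfl fun j _ => by ring
    let A : ι → ι → ℝ := fun i j => if j = i then 0 else |L i j|
    have hA : ∀ i, ∑ j, A i j ≤ L i i := by
      intro i
      refine le_trans (le_of_eq ?_) (hdd i)
      rw [Finset.sum_filter]
      exact Finset.sum_congr rfl fun j _ => by by_cases h : j = i <;> simp [A, h]
    have hAs : ∀ i j, A i j = A j i := by
      intro i j
      have := hsymm.apply i j
      by_cases h : j = i
      · subst h; rfl
      · have h' : ¬ i = j := fun e => h e.symm
        simp [A, h, h', this]
    have hle : ∀ i, (∑ j, (-(A i j * (x i ^ 2 + x j ^ 2)))) + 2 * L i i * x i ^ 2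
        ≤ ∑ j, L i j * (2 * x i * x j) := by
      intro i
      have : 2 * L i i * x i ^ 2 = ∑ j, if j = i then 2 * L i i * x i ^ 2 else 0 := by simp
      rw [this, ← Finset.sum_add_distrib]
      refine Finset.sum_le_sum fun j _ => ?_
      by_cases h : j = i
      · subst h; simp [A]; apply le_of_eq; ring
      · simp only [A, h, if_false]
        have h1 := neg_abs_le (L i j)
        have h2 := le_abs_self (L i j)
        nlinarith [sq_nonneg (x i + x j), sq_nonneg (x i - x j)]
    have hsum := Finset.sum_le_sum fun i (_ : i ∈ Finset.univ) => hle i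
    rw [Finset.sum_add_distrib] at hsum
    have e1 : ∑ i, ∑ j, (-(A i j * (x i ^ 2 + x j ^ 2))) = - (2 * ∑ i, (∑ j, A i j) * x i ^ 2) := by
      have a1 : ∑ i, ∑ j, A i j * x j ^ 2 = ∑ i, ∑ j, A i j * x i ^ 2 := by
        rw [Finset.sum_comm]
        exact Finset.sum_congr rfl fun i _ => Finset.sum_congr rfl fun j _ => by rw [hAs]
      simp only [mul_add, Finset.sum_neg_distrib, Finset.sum_add_distrib, a1, Finset.sum_mul]
      ring
    have e2 : ∑ i, (∑ j, A i j) * x i ^ 2 ≤ ∑ i, L i i * x i ^ 2 :=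
      Finset.sum_le_sum fun i _ => mul_le_mul_of_nonneg_right (hA i) (sq_nonneg _)
    have e3 : ∑ i, 2 * L i i * x i ^ 2 = 2 * ∑ i, L i i * x i ^ 2 := by
      rw [Finset.mul_sum]; exact Finset.sum_congr rfl fun i _ => by ring
    rw [star_trivial]
    linarith
  exact hps.posDef_iff_isUnit.mpr hinv

lemma ps_tri {ι : Type*} [Fintype ι] (f g h : ι → ℝ) :
    Real.sqrt (∑ a, (f a - h a) ^ 2) ≤ Real.sqrt (∑ a, (f a - g a) ^ 2)
      + Real.sqrt (∑ a, (g a - h a) ^ 2) := by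
  have := norm_add_le (WithLp.toLp 2 (f - g) : EuclideanSpace ℝ ι) (WithLp.toLp 2 (g - h))
  rw [← WithLp.toLp_add] at this
  simpa [EuclideanSpace.norm_eq] using this

lemma ps_core {ι : Type*} [Fintype ι] [DecidableEq ι] (M : Matrix ι ι ℝ) (hP : M.PosDef)
    (hoff : ∀ i j, i ≠ j → M i j ≤ 0) (hrow : ∀ i, 0 ≤ ∑ j, M i j)
    (H : Finset ι) (b : ι → ℝ) (hb : ∀ a, 0 ≤ b a)
    (c : ℝ) (hc0 : 0 ≤ c) (hc : ∀ u, u ∉ H → M⁻¹.mulVec b u ≤ c)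
    (MH : Matrix {a : ι // a ∈ H} {a : ι // a ∈ H} ℝ)
    (hMH : MH = M.submatrix (fun a => a.1) (fun a => a.1)) :
    (∀ u, 0 ≤ M⁻¹.mulVec b u) ∧
    ∀ u : {a // a ∈ H}, |MH⁻¹.mulVec (fun c : {a // a ∈ H} => b c.1) u - M⁻¹.mulVec b u.1| ≤ c := by
  have hPH : MH.PosDef := by
    rw [hMH]; exact hP.submatrix Subtype.val_injective
  have hoffH : ∀ i j, i ≠ j → MH i j ≤ 0 := by
    intro i j hij
    rw [hMH]; exact hoff _ _ fun e => hij (Subtype.ext e)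
  set x := M⁻¹.mulVec b with hx
  have hMx : M.mulVec x = b := by
    rw [hx, Matrix.mulVec_mulVec, Matrix.mul_nonsing_inv _ ((Matrix.isUnit_iff_isUnit_det _).mp hP.isUnit),
      Matrix.one_mulVec]
  have hx0 : ∀ u, 0 ≤ x u := ps_mono M hP hoff x fun i => by rw [hMx]; exact hb i
  refine ⟨hx0, ?_⟩
  set y := MH⁻¹.mulVec (fun c : {a // a ∈ H} => b c.1) with hy
  have hMy : MH.mulVec y = fun c : {a // a ∈ H} => b c.1 := by
    rw [hy, Matrix.mulVec_mulVec, Matrix.mul_nonsing_inv _ ((Matrix.isUnit_iff_isUnit_det _).mp hPH.isUnit),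
      Matrix.one_mulVec]
  have hsplit : ∀ (u : {a // a ∈ H}) (z : ι → ℝ), M.mulVec z u.1 =
      MH.mulVec (fun a => z a.1) u + ∑ j ∈ Hᶜ, M u.1 j * z j := by
    intro u z
    simp only [Matrix.mulVec, dotProduct, hMH, Matrix.submatrix_apply]
    rw [← Finset.sum_add_sum_compl H]
    congr 1
    exact (Finset.sum_coe_sort H (fun j => M u.1 j * z j)).symm
  have hoffF : ∀ (u : {a // a ∈ H}), ∀ j ∈ Hᶜ, M u.1 j ≤ 0 := by
    intro u j hj
    refine hoff _ _ ?_
    rintro rfl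
    exact (Finset.mem_compl.mp hj) u.2
  have hlo := ps_mono MH hPH hoffH ((fun a => x a.1) - y) (by
    intro u
    rw [Matrix.mulVec_sub, hMy, Pi.sub_apply]
    have h1 := hsplit u x
    rw [hMx] at h1
    have h2 : ∑ j ∈ Hᶜ, M u.1 j * x j ≤ 0 :=
      Finset.sum_nonpos fun j hj => mul_nonpos_of_nonpos_of_nonneg (hoffF u j hj) (hx0 j)
    linarith)
  have hhi := ps_mono MH hPH hoffH ((fun _ => c) - ((fun a => x a.1) - y)) (by
    intro u
    rw [Matrix.mulVec_sub, Matrix.mulVec_sub, hMy, Pi.sub_apply, Pi.sub_apply]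
    have h1 := hsplit u x
    rw [hMx] at h1
    have h3 := hsplit u (fun _ => c)
    have h4 : 0 ≤ M.mulVec (fun _ => c) u.1 := by
      simp only [Matrix.mulVec, dotProduct, ← Finset.sum_mul]
      exact mul_nonneg (hrow _) hc0
    have h2 : ∑ j ∈ Hᶜ, M u.1 j * c ≤ ∑ j ∈ Hᶜ, M u.1 j * x j :=
      Finset.sum_le_sum fun j hj => mul_le_mul_of_nonpos_left
        (hc j (Finset.mem_compl.mp hj)) (hoffF u j hj)
    linarith)
  intro u
  have a1 := hlo u
  have a2 := hhi u
  simp only [Pi.sub_apply] at a1 a2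
  rw [abs_le]
  constructor <;> linarith


/-- correctness of `PartialSolve`.  Let `L` be an `n × n` invertible
SDDM matrix with integer entries in `[-U, U]` (`U ≥ 2`, `n ≥ 2`), `S ⊆ [n]`, `b̂` a
nonnegative vector indexed by `S` with support `I := {u ∈ S : b̂ᵤ > 0}`, `H` a set with
`I ⊆ H ⊆ S`, and `ε_L ∈ (0,1)`.  Suppose `r ≥ 5 + log_{nU}(2/ε_L)` is such that the
probability distance w.r.t. `L_{S,S}` satisfies `D_{L_{S,S}}(u, v) > r` for all
`u ∈ S \ H`, `v ∈ I` (equivalently `((L_{S,S})⁻¹)ᵤᵥ < (nU)^{2-r}`).  If `x̂` vanishes on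
`S \ H` and `‖x̂_H − (L_{H,H})⁻¹ b̂_H‖₂ ≤ (ε_L/2) ‖b̂_H‖₂`, then
`‖x̂ − (L_{S,S})⁻¹ b̂‖₂ ≤ ε_L ‖b̂‖₂`. -/
theorem partial_solve_correctness {n : ℕ} (hn : 2 ≤ n) (U : ℕ) (hU : 2 ≤ U)
    (L : Matrix (Fin n) (Fin n) ℝ)
    (hsymm : L.IsSymm)
    (hoff : ∀ i j, i ≠ j → L i j ≤ 0)
    (hdiag : ∀ i, 0 < L i i)
    (hdd : ∀ i, ∑ j ∈ Finset.univ.filter (fun j => j ≠ i), |L i j| ≤ L i i)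
    (hint : ∀ i j, ∃ z : ℤ, L i j = (z : ℝ))
    (hbd : ∀ i j, |L i j| ≤ (U : ℝ))
    (hinv : IsUnit L)
    (S : Finset (Fin n))
    -- `M = L_{S,S}`
    (M : Matrix {x // x ∈ S} {x // x ∈ S} ℝ)
    (hM : M = L.submatrix (fun a : {x // x ∈ S} => (a : Fin n))
      (fun a : {x // x ∈ S} => (a : Fin n)))
    (bhat : {x // x ∈ S} → ℝ) (hbhat : ∀ a, 0 ≤ bhat a)
    (H : Finset {x // x ∈ S})
    -- `I := {u ∈ S : b̂ᵤ > 0} ⊆ H`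
    (hIH : ∀ a, 0 < bhat a → a ∈ H)
    (εL : ℝ) (hε0 : 0 < εL) (hε1 : εL < 1)
    (r : ℝ) (hr : 5 + Real.logb ((n : ℝ) * U) (2 / εL) ≤ r)
    -- `D_{L_{S,S}}(u, v) > r` for `u ∈ S \ H` and `v` in the support `I` of `b̂`
    (hfar : ∀ u : {x // x ∈ S}, u ∉ H → ∀ v : {x // x ∈ S}, 0 < bhat v →
      M⁻¹ u v < ((n : ℝ) * U) ^ ((2 : ℝ) - r))
    -- `MH = L_{H,H}`
    (MH : Matrix {a : {x // x ∈ S} // a ∈ H} {a : {x // x ∈ S} // a ∈ H} ℝ)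
    (hMH : MH = M.submatrix (fun a => a.1) (fun a => a.1))
    (xhat : {x // x ∈ S} → ℝ)
    (hx0 : ∀ a, a ∉ H → xhat a = 0)
    (hxH : Real.sqrt (∑ a : {a : {x // x ∈ S} // a ∈ H},
        (xhat a.1 - MH⁻¹.mulVec (fun c : {a : {x // x ∈ S} // a ∈ H} => bhat c.1) a) ^ 2)
      ≤ εL / 2 * Real.sqrt (∑ a : {a : {x // x ∈ S} // a ∈ H}, bhat a.1 ^ 2)) :
    Real.sqrt (∑ a : {x // x ∈ S}, (xhat a - M⁻¹.mulVec bhat a) ^ 2)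
      ≤ εL * Real.sqrt (∑ a : {x // x ∈ S}, bhat a ^ 2) := by
  have hLP := ps_posDef L hsymm hdd hinv
  have hP : M.PosDef := by
    rw [hM]; exact hLP.submatrix Subtype.val_injective
  have hoffM : ∀ i j, i ≠ j → M i j ≤ 0 := by
    intro i j hij
    rw [hM]; exact hoff _ _ fun e => hij (Subtype.ext e)
  have hrow : ∀ i, 0 ≤ ∑ j, M i j := by
    intro i
    have h1 : ∑ j, M i j = ∑ j ∈ S, L i.1 j := by
      rw [hM]; exact Finset.sum_coe_sort S (fun j => L i.1 j)
    have h2 : ∑ j ∈ S, L i.1 j = L i.1 i.1 + ∑ j ∈ S.erase i.1, L i.1 j :=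
      (Finset.add_sum_erase S _ i.2).symm
    have h3 : -∑ j ∈ S.erase i.1, L i.1 j ≤ ∑ j ∈ S.erase i.1, |L i.1 j| := by
      rw [← Finset.sum_neg_distrib]
      exact Finset.sum_le_sum fun j _ => neg_le_abs _
    have h4 : ∑ j ∈ S.erase i.1, |L i.1 j| ≤
        ∑ j ∈ Finset.univ.filter (fun j => j ≠ i.1), |L i.1 j| := by
      refine Finset.sum_le_sum_of_subset_of_nonneg ?_ fun _ _ _ => abs_nonneg _
      intro j hj
      simp [Finset.ne_of_mem_erase hj]
    have h5 := hdd i.1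
    linarith
  set N : ℝ := (n : ℝ) * U with hN
  have hn' : (2 : ℝ) ≤ n := by exact_mod_cast hn
  have hU' : (2 : ℝ) ≤ U := by exact_mod_cast hU
  have hNn : (n : ℝ) ≤ N := by rw [hN]; nlinarith
  have hN1 : 1 < N := by linarith
  have hN0 : 0 < N := by linarith
  set B := Real.sqrt (∑ a : {x // x ∈ S}, bhat a ^ 2) with hB
  have hB0 : 0 ≤ B := Real.sqrt_nonneg _
  have hcard : (Fintype.card {x // x ∈ S} : ℝ) ≤ n := by
    have := Finset.card_le_univ S
    rw [Fintype.card_fin] at this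
    rw [Fintype.card_coe]; exact_mod_cast this
  set q := N ^ ((2 : ℝ) - r) with hq
  have hq0 : 0 < q := Real.rpow_pos_of_pos hN0 _
  have hq1 : q * n ≤ εL / 2 := by
    have h1 : q ≤ N ^ (-(3 : ℝ) - Real.logb N (2 / εL)) :=
      Real.rpow_le_rpow_of_exponent_le hN1.le (by linarith)
    have h2 : N ^ (-(3 : ℝ) - Real.logb N (2 / εL)) = N ^ (-(3 : ℝ)) / (2 / εL) := by
      rw [Real.rpow_sub hN0, Real.rpow_logb hN0 hN1.ne' (by positivity)]
    have h3 : N ^ (-(3 : ℝ)) ≤ N⁻¹ := by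
      rw [← Real.rpow_neg_one]
      exact Real.rpow_le_rpow_of_exponent_le hN1.le (by norm_num)
    have h4 : q ≤ N⁻¹ * (εL / 2) := by
      refine h1.trans ?_
      rw [h2, div_eq_mul_inv, inv_div]
      exact mul_le_mul_of_nonneg_right h3 (by positivity)
    calc q * n ≤ N⁻¹ * (εL / 2) * N := by gcongr
      _ = εL / 2 := by field_simp
  set T := ∑ a : {x // x ∈ S}, bhat a with hT
  have hT0 : 0 ≤ T := Finset.sum_nonneg fun a _ => hbhat a
  have hTB : T ≤ Real.sqrt n * B := by
    rw [hB, ← Real.sqrt_mul (by positivity)]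
    apply Real.le_sqrt_of_sq_le
    have := sq_sum_le_card_mul_sum_sq (s := Finset.univ) (f := bhat)
    refine this.trans (mul_le_mul_of_nonneg_right ?_ (Finset.sum_nonneg fun _ _ => sq_nonneg _))
    simpa using hcard
  have hc : ∀ u, u ∉ H → M⁻¹.mulVec bhat u ≤ q * T := by
    intro u hu
    rw [hT, Finset.mul_sum]
    refine Finset.sum_le_sum fun v _ => ?_
    rcases (hbhat v).eq_or_lt with h | h
    · simp [← h]
    · exact mul_le_mul_of_nonneg_right (hfar u hu v h).le h.le
  obtain ⟨hx, hd⟩ := ps_core M hP hoffM hrow H bhat hbhat (q * T) (by positivity) hc MH hMH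
  let y : {x // x ∈ S} → ℝ := fun a => if h : a ∈ H then
    MH⁻¹.mulVec (fun c : {a : {x // x ∈ S} // a ∈ H} => bhat c.1) ⟨a, h⟩ else 0
  have hy1 : ∀ a : {a : {x // x ∈ S} // a ∈ H}, y a.1 =
      MH⁻¹.mulVec (fun c : {a : {x // x ∈ S} // a ∈ H} => bhat c.1) a := by
    intro a
    simp [y, a.2]
  have hy0 : ∀ a, a ∉ H → y a = 0 := fun a ha => by simp [y, ha]
  have hyd : ∀ a, (y a - M⁻¹.mulVec bhat a) ^ 2 ≤ (q * T) ^ 2 := by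
    intro a
    apply sq_le_sq'
    · by_cases ha : a ∈ H
      · have := abs_le.mp (hd ⟨a, ha⟩)
        rw [← hy1] at this
        exact this.1
      · rw [hy0 a ha]; have := hc a ha; linarith
    · by_cases ha : a ∈ H
      · have := abs_le.mp (hd ⟨a, ha⟩)
        rw [← hy1] at this
        exact this.2
      · rw [hy0 a ha]
        have := hx a
        have : 0 ≤ q * T := by positivity
        linarith
  have hs2 : Real.sqrt (∑ a, (y a - M⁻¹.mulVec bhat a) ^ 2) ≤ εL / 2 * B := by
    have h1 : ∑ a, (y a - M⁻¹.mulVec bhat a) ^ 2 ≤ n * (q * T) ^ 2 := by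
      refine (Finset.sum_le_sum fun a _ => hyd a).trans ?_
      rw [Finset.sum_const, nsmul_eq_mul, Finset.card_univ]
      exact mul_le_mul_of_nonneg_right hcard (sq_nonneg _)
    calc Real.sqrt (∑ a, (y a - M⁻¹.mulVec bhat a) ^ 2) ≤ Real.sqrt (n * (q * T) ^ 2) :=
          Real.sqrt_le_sqrt h1
      _ = Real.sqrt n * (q * T) := by
          rw [Real.sqrt_mul (by positivity), Real.sqrt_sq (by positivity)]
      _ ≤ Real.sqrt n * (q * (Real.sqrt n * B)) := by gcongr
      _ = q * (Real.sqrt n * Real.sqrt n) * B := by ring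
      _ = q * n * B := by rw [Real.mul_self_sqrt (by positivity)]
      _ ≤ εL / 2 * B := by gcongr
  have hs1 : Real.sqrt (∑ a, (xhat a - y a) ^ 2) ≤ εL / 2 * B := by
    have h1 : ∑ a, (xhat a - y a) ^ 2 = ∑ a : {a : {x // x ∈ S} // a ∈ H},
        (xhat a.1 - MH⁻¹.mulVec (fun c : {a : {x // x ∈ S} // a ∈ H} => bhat c.1) a) ^ 2 := by
      simp only [← hy1]
      rw [Finset.sum_coe_sort H (fun a => (xhat a - y a) ^ 2)]
      symm
      refine Finset.sum_subset (Finset.subset_univ _) fun a _ ha => ?_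
      rw [hx0 a ha, hy0 a ha]; norm_num
    rw [h1]
    refine hxH.trans ?_
    refine mul_le_mul_of_nonneg_left (Real.sqrt_le_sqrt ?_) (by positivity)
    rw [Finset.sum_coe_sort H (fun a => bhat a ^ 2)]
    exact Finset.sum_le_sum_of_subset_of_nonneg (Finset.subset_univ _) fun _ _ _ => sq_nonneg _
  have := ps_tri xhat y (M⁻¹.mulVec bhat)
  linarith
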